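/- arXiv:1710.00754 — 2 statements merged into one kernel-verified Lean document; each statement's English description precedes it below -/
import Mathlib

section
/- There exists R₀ > 0 such that for every small-hard-star background (r₀, m₀, ρ₀) in comoving coordinates on [0,B] with surface radius R = r₀(B) < R₀, the second-variation quadratic form is nonnegative: Q[u,v] ≥ 0 for every u ∈ C¹([0,B]) with u(0) = 0 and every continuous v : [0,B] → ℝ; moreover Q[u,v] = 0 if and only if u ≡ 0 and v ≡ 0. Consequently, small static hard stars are local minima of the mass-energy functional under variations preserving the total particle number. -/
open Real Set Filter

noncomputable section

/-- `f` is C¹ on `s`. -/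
def C1On (f : ℝ → ℝ) (s : Set ℝ) : Prop :=
  (∀ x ∈ s, DifferentiableAt ℝ f x) ∧ ContinuousOn (deriv f) s

/-- A small hard star of radius `R` with smallness constant `C`
(units `G = c = ρ₀ = 1`). -/
def IsSmallStar (C R : ℝ) (m ρ : ℝ → ℝ) : Prop :=
  0 < R ∧ ContinuousOn m (Icc 0 R) ∧ ContinuousOn ρ (Icc 0 R) ∧
  m 0 = 0 ∧ ρ R = 1 ∧
  (∀ r ∈ Ioo (0:ℝ) R,
    HasDerivAt m (4 * π * r ^ 2 * ρ r) r ∧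
    HasDerivAt ρ (-((2 * ρ r - 1) / (r - 2 * m r)) *
      (m r / r + 4 * π * r ^ 2 * (ρ r - 1))) r) ∧
  (∀ r ∈ Ioc (0:ℝ) R,
    1 ≤ ρ r ∧ ρ r ≤ 1 + C * R ^ 2 ∧
    1 ≤ 3 / (4 * π) * (m r / r ^ 3) ∧
    3 / (4 * π) * (m r / r ^ 3) ≤ 1 + C * R ^ 2)

/-- The comoving derivative `dr/dχ = g(r) = √(1 − 2m(r)/r)/(4πr²√(2ρ(r)−1))`. -/
def gfun (m ρ : ℝ → ℝ) (r : ℝ) : ℝ :=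
  Real.sqrt (1 - 2 * m r / r) / (4 * π * r ^ 2 * Real.sqrt (2 * ρ r - 1))

/-- Comoving coordinates: `r₀ : [0,B] → [0,R]` solves `∂_χ r₀ = g(r₀)`,
`r₀(0) = 0`, `r₀(B) = R`. -/
def IsComoving (R B : ℝ) (m ρ r₀ : ℝ → ℝ) : Prop :=
  0 < B ∧ r₀ 0 = 0 ∧ r₀ B = R ∧ ContinuousOn r₀ (Icc 0 B) ∧
  (∀ χ ∈ Icc (0:ℝ) B, r₀ χ ∈ Icc 0 R) ∧
  ∀ χ ∈ Ioc (0:ℝ) B, HasDerivAt r₀ (gfun m ρ (r₀ χ)) χ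

/-- Integrand of the second-variation quadratic form `Q[u,v]`. -/
def Qint (m ρ r₀ : ℝ → ℝ) (u v : ℝ → ℝ) (χ : ℝ) : ℝ :=
  (8 * π * ρ (r₀ χ) * gfun m ρ (r₀ χ) * u χ ^ 2
    + 16 * π * r₀ χ * ρ (r₀ χ) * u χ * deriv u χ
    - 6 * ((4 * π * r₀ χ * (ρ (r₀ χ) - 1) + m (r₀ χ) / r₀ χ ^ 2) /
        (4 * π * r₀ χ ^ 3 * gfun m ρ (r₀ χ))) * u χ ^ 2
    + 2 * ((1 - 2 * m (r₀ χ) / r₀ χ) / (4 * π * r₀ χ ^ 4 * gfun m ρ (r₀ χ))) * u χ ^ 2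
    - 2 * ((4 * π * r₀ χ * (ρ (r₀ χ) - 1) + m (r₀ χ) / r₀ χ ^ 2) /
        (4 * π * r₀ χ ^ 2 * gfun m ρ (r₀ χ) ^ 2)) * u χ * deriv u χ
    + ((1 - 2 * m (r₀ χ) / r₀ χ) / (4 * π * r₀ χ ^ 2 * gfun m ρ (r₀ χ) ^ 3)) *
        deriv u χ ^ 2
    + ((2 * ρ (r₀ χ) - 1) / (4 * π * r₀ χ ^ 2 * gfun m ρ (r₀ χ))) * v χ ^ 2) *
  Real.exp (∫ s in (0:ℝ)..χ, 1 / (4 * π * r₀ s ^ 3 * gfun m ρ (r₀ s)))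

/-- The second-variation quadratic form `Q[u,v]`. -/
def Qform (m ρ r₀ : ℝ → ℝ) (B : ℝ) (u v : ℝ → ℝ) : ℝ :=
  ∫ χ in (0:ℝ)..B, Qint m ρ r₀ u v χ

theorem bracket_eq (ρ r a μ x w v g : ℝ) (hr : 0 < r) (ha : 0 < a)
    (hg : g = a / (4 * π * r ^ 2)) :
    8 * π * ρ * g * (x * r) ^ 2 + 16 * π * r * ρ * (x * r) * (w * g)
      - 6 * ((4 * π * r * (ρ - 1) + (μ * r) / r ^ 2) / (4 * π * r ^ 3 * g)) * (x * r) ^ 2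
      + 2 * ((1 - 2 * (μ * r) / r) / (4 * π * r ^ 4 * g)) * (x * r) ^ 2
      - 2 * ((4 * π * r * (ρ - 1) + (μ * r) / r ^ 2) / (4 * π * r ^ 2 * g ^ 2)) * (x * r) * (w * g)
      + ((1 - 2 * (μ * r) / r) / (4 * π * r ^ 2 * g ^ 3)) * (w * g) ^ 2
      + ((2 * ρ - 1) / (4 * π * r ^ 2 * g)) * v ^ 2
    = (2 * ρ * a - 6 * (4 * π * r ^ 2 * (ρ - 1) + μ) * a⁻¹ + 2 * (1 - 2 * μ) * a⁻¹) * x ^ 2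
      + (4 * ρ * a - 2 * (4 * π * r ^ 2 * (ρ - 1) + μ) * a⁻¹) * (x * w)
      + (1 - 2 * μ) * a⁻¹ * w ^ 2 + (2 * ρ - 1) * a⁻¹ * v ^ 2 := by
  have := pi_pos
  subst hg
  field_simp
  ring

theorem flux_eq (r a x w g : ℝ) (hr : 0 < r) (ha : 0 < a)
    (hg : g = a / (4 * π * r ^ 2)) :
    4 * π * (g * (x * r) ^ 2 + 2 * r * (x * r) * (w * g)
      + r * (x * r) ^ 2 * (1 / (4 * π * r ^ 3 * g)))
    = (a + 4 * π * r ^ 2 * a⁻¹) * x ^ 2 + 2 * a * (x * w) := by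
  have := pi_pos
  subst hg
  field_simp
  ring

theorem quad_lower (α β γ δ x w v : ℝ) (hα : 5 / 2 ≤ α) (hβ : |β| ≤ 11 / 5)
    (hγ : 9 / 10 ≤ γ) (hδ : 1 / 4 ≤ δ) :
    (x ^ 2 + w ^ 2 + v ^ 2) / 4 ≤ α * x ^ 2 + β * (x * w) + γ * w ^ 2 + δ * v ^ 2 := by
  obtain ⟨h1, h2⟩ := abs_le.1 hβ
  have e1 := mul_nonneg (sub_nonneg.2 hα) (sq_nonneg x)
  have e2 := mul_nonneg (sub_nonneg.2 hγ) (sq_nonneg w)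
  have e3 := mul_nonneg (sub_nonneg.2 hδ) (sq_nonneg v)
  have e4 := mul_nonneg (sub_nonneg.2 h2) (sq_nonneg (8 * x - 5 * w))
  have e5 := mul_nonneg (sub_nonneg.2 h1) (sq_nonneg (8 * x + 5 * w))
  nlinarith [sq_nonneg x, sq_nonneg w, sq_nonneg (9 * x - 7 * w), sq_nonneg (9 * x + 7 * w)]

theorem quad_abs_le (α β γ δ K x w v : ℝ) (hα : |α| ≤ K) (hβ : |β| ≤ K)
    (hγ : |γ| ≤ K) (hδ : |δ| ≤ K) :
    |α * x ^ 2 + β * (x * w) + γ * w ^ 2 + δ * v ^ 2| ≤ 2 * K * (x ^ 2 + w ^ 2 + v ^ 2) := by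
  have hK : 0 ≤ K := (abs_nonneg _).trans hα
  have e1 : |α * x ^ 2| ≤ K * x ^ 2 := by
    rw [abs_mul, abs_of_nonneg (sq_nonneg x)]; gcongr
  have e2 : |γ * w ^ 2| ≤ K * w ^ 2 := by
    rw [abs_mul, abs_of_nonneg (sq_nonneg w)]; gcongr
  have e3 : |δ * v ^ 2| ≤ K * v ^ 2 := by
    rw [abs_mul, abs_of_nonneg (sq_nonneg v)]; gcongr
  have e4 : |β * (x * w)| ≤ K * (x ^ 2 + w ^ 2) := by
    rw [abs_mul]
    have : |x * w| ≤ x ^ 2 + w ^ 2 := abs_le.2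
      ⟨by nlinarith [sq_nonneg (x + w), sq_nonneg x, sq_nonneg w],
        by nlinarith [sq_nonneg (x - w), sq_nonneg x, sq_nonneg w]⟩
    gcongr
  have := abs_add_le (α * x ^ 2 + β * (x * w) + γ * w ^ 2) (δ * v ^ 2)
  have := abs_add_le (α * x ^ 2 + β * (x * w)) (γ * w ^ 2)
  have := abs_add_le (α * x ^ 2) (β * (x * w))
  nlinarith [mul_nonneg hK (sq_nonneg v)]

theorem coeff_bounds (ρ a μ q : ℝ) (ha : 19 / 20 ≤ a) (ha1 : a ≤ 1) (hρ : 1 ≤ ρ)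
    (hρ1 : ρ ≤ 101 / 100) (hμ : 0 ≤ μ) (hμ1 : μ ≤ 1 / 100) (hq : 0 ≤ q) (hq1 : q ≤ 1 / 100) :
    5 / 2 ≤ 2 * ρ * a - 6 * (q * (ρ - 1) + μ) * a⁻¹ + 2 * (1 - 2 * μ) * a⁻¹ - (a + q * a⁻¹) ∧
    |4 * ρ * a - 2 * (q * (ρ - 1) + μ) * a⁻¹ - 2 * a| ≤ 11 / 5 ∧
    9 / 10 ≤ (1 - 2 * μ) * a⁻¹ ∧ 1 / 4 ≤ (2 * ρ - 1) * a⁻¹ ∧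
    |2 * ρ * a - 6 * (q * (ρ - 1) + μ) * a⁻¹ + 2 * (1 - 2 * μ) * a⁻¹| ≤ 10 ∧
    |4 * ρ * a - 2 * (q * (ρ - 1) + μ) * a⁻¹| ≤ 10 ∧
    |(1 - 2 * μ) * a⁻¹| ≤ 10 ∧ |(2 * ρ - 1) * a⁻¹| ≤ 10 ∧
    |a + q * a⁻¹| ≤ 10 ∧ |2 * a| ≤ 10 := by
  have ha0 : 0 < a := by linarith
  have hb : 1 ≤ a⁻¹ := (one_le_inv₀ ha0).2 ha1
  have hb1 : a⁻¹ ≤ 20 / 19 := by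
    rw [inv_le_comm₀ ha0 (by norm_num)]; norm_num; exact ha
  set b := a⁻¹
  have hb0 : 0 ≤ b := by linarith
  have hn0 : 0 ≤ q * (ρ - 1) := mul_nonneg hq (by linarith)
  have hn1 : q * (ρ - 1) ≤ 1 / 100 := by nlinarith
  set t := q * (ρ - 1)
  have p0 : 0 ≤ (t + μ) * b := by positivity
  have p1 : (t + μ) * b ≤ 2 / 95 := by
    calc (t + μ) * b ≤ (2 / 100) * (20 / 19) := by gcongr; linarith
      _ ≤ 2 / 95 := by norm_num
  have q0 : 0 ≤ q * b := by positivity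
  have q1 : q * b ≤ 1 / 95 := by
    calc q * b ≤ (1 / 100) * (20 / 19) := by gcongr
      _ ≤ 1 / 95 := by norm_num
  have r0 : 0 ≤ μ * b := by positivity
  have r1 : μ * b ≤ 1 / 95 := by
    calc μ * b ≤ (1 / 100) * (20 / 19) := by gcongr
      _ ≤ 1 / 95 := by norm_num
  have s0 : a ≤ ρ * a := by nlinarith
  have s1 : ρ * a ≤ 101 / 100 := by nlinarith
  have t0 : b ≤ ρ * b := by nlinarith
  have t1 : ρ * b ≤ 11 / 10 := by nlinarith
  refine ⟨?_, abs_le.2 ⟨?_, ?_⟩, ?_, ?_, abs_le.2 ⟨?_, ?_⟩, abs_le.2 ⟨?_, ?_⟩, abs_le.2 ⟨?_, ?_⟩,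
    abs_le.2 ⟨?_, ?_⟩, abs_le.2 ⟨?_, ?_⟩, abs_le.2 ⟨?_, ?_⟩⟩ <;> linarith

/-- Quantitative closeness to the flat background on `(0, R]`. -/
def NearFlat (R : ℝ) (m ρ : ℝ → ℝ) : Prop :=
  ∀ r ∈ Ioc (0:ℝ) R,
    (19 / 20 ≤ 4 * π * r ^ 2 * gfun m ρ r ∧ 4 * π * r ^ 2 * gfun m ρ r ≤ 1) ∧
    (1 ≤ ρ r ∧ ρ r ≤ 101 / 100) ∧ (0 ≤ m r / r ∧ m r / r ≤ 1 / 100) ∧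
    4 * π * r ^ 2 ≤ 1 / 100

theorem IsSmallStar.nearFlat {C R : ℝ} {m ρ : ℝ → ℝ} (h : IsSmallStar C R m ρ) (hC : 0 < C)
    (hR : R * (50 + 100 * C) < 1) : NearFlat R m ρ := by
  obtain ⟨hR0, -, -, -, -, -, hb⟩ := h
  intro r hr
  obtain ⟨h1, h2, h3, h4⟩ := hb r hr
  have hr0 : 0 < r := hr.1
  have hπ := pi_pos
  have hRC : 0 < R * C := by positivity
  have hR50 : R < 1 / 50 := by nlinarith
  have hCR : C * R ^ 2 ≤ 1 / 100 := by nlinarith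
  have hq : 4 * π * r ^ 2 ≤ 1 / 100 := by
    have : r ^ 2 ≤ (1 / 50) ^ 2 := pow_le_pow_left₀ hr0.le (hr.2.trans hR50.le) 2
    nlinarith [pi_lt_d2]
  have hμ : m r / r = (3 / (4 * π) * (m r / r ^ 3)) * (4 * π * r ^ 2) / 3 := by
    field_simp
  have hμ0 : 0 ≤ m r / r := by
    rw [hμ]
    have : 0 ≤ 3 / (4 * π) * (m r / r ^ 3) := by linarith
    positivity
  have hμ1 : m r / r ≤ 1 / 100 := by
    rw [hμ]
    have hq0 : 0 ≤ 4 * π * r ^ 2 := by positivity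
    nlinarith
  refine ⟨?_, ⟨h1, by linarith⟩, ⟨hμ0, hμ1⟩, hq⟩
  have e : 4 * π * r ^ 2 * gfun m ρ r = √(1 - 2 * m r / r) / √(2 * ρ r - 1) := by
    unfold gfun
    field_simp
  rw [e, mul_div_assoc]
  have s1 : 1 ≤ √(2 * ρ r - 1) := by
    rw [one_le_sqrt]; linarith
  have s2 : √(2 * ρ r - 1) ≤ 102 / 100 := by
    rw [sqrt_le_left (by norm_num)]; linarith
  have s3 : √(1 - 2 * (m r / r)) ≤ 1 := by
    rw [sqrt_le_left (by norm_num)]; linarith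
  have s4 : 98 / 100 ≤ √(1 - 2 * (m r / r)) := by
    exact le_sqrt_of_sq_le (by linarith)
  constructor
  · rw [le_div_iff₀ (by linarith)]; linarith
  · rw [div_le_one₀ (by linarith)]; linarith

theorem NearFlat.gfun_lower {R : ℝ} {m ρ : ℝ → ℝ} (h : NearFlat R m ρ) {r : ℝ}
    (hr : r ∈ Ioc 0 R) : 19 / 20 / (4 * π * R ^ 2) ≤ gfun m ρ r := by
  have h1 := (h r hr).1.1
  have hr0 : 0 < r := hr.1
  have hR0 : 0 < R := hr0.trans_le hr.2
  have hπ := pi_pos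
  have hg : 0 ≤ gfun m ρ r := by unfold gfun; positivity
  rw [div_le_iff₀ (by positivity)]
  have : 4 * π * r ^ 2 * gfun m ρ r ≤ 4 * π * R ^ 2 * gfun m ρ r := by
    gcongr; exact hr.2
  linarith

theorem NearFlat.gfun_pos {R : ℝ} {m ρ : ℝ → ℝ} (h : NearFlat R m ρ) {r : ℝ}
    (hr : r ∈ Ioc 0 R) : 0 < gfun m ρ r := by
  have hR0 : 0 < R := hr.1.trans_le hr.2
  have hπ := pi_pos
  exact lt_of_lt_of_le (by positivity) (h.gfun_lower hr)

theorem NearFlat.gfun_eq {R : ℝ} {m ρ : ℝ → ℝ} {r : ℝ} (hr : r ∈ Ioc 0 R) :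
    gfun m ρ r = (4 * π * r ^ 2 * gfun m ρ r) / (4 * π * r ^ 2) := by
  have hr0 : 0 < r := hr.1
  have hπ := pi_pos
  field_simp

theorem IsComoving.mapsTo {R B : ℝ} {m ρ r₀ : ℝ → ℝ} (h : IsComoving R B m ρ r₀) (hR : 0 < R)
    (hf : NearFlat R m ρ) : MapsTo r₀ (Ioc 0 B) (Ioc 0 R) := by
  obtain ⟨hB, -, hrB, -, hmem, hd⟩ := h
  intro χ hχ
  refine ⟨?_, (hmem χ ⟨hχ.1.le, hχ.2⟩).2⟩
  by_contra! hle
  have hz : r₀ χ = 0 := le_antisymm hle (hmem χ ⟨hχ.1.le, hχ.2⟩).1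
  have hπ := pi_pos
  have hc : 0 < 19 / 20 / (4 * π * R ^ 2) := by positivity
  have hg0 : gfun m ρ 0 = 0 := by simp [gfun]
  -- Darboux: the derivative `g(r₀)` would take values strictly between `0` and its lower bound.
  obtain ⟨y, hy, hyv⟩ := exists_hasDerivWithinAt_eq_of_gt_of_lt (f := r₀)
    (f' := fun x => gfun m ρ (r₀ x)) (m := 19 / 20 / (4 * π * R ^ 2) / 2) hχ.2
    (fun x hx => (hd x ⟨hχ.1.trans_le hx.1, hx.2⟩).hasDerivWithinAt)
    (by simp only [hz, hg0]; positivity)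
    (by
      have := hf.gfun_lower (r := r₀ B) (by rw [hrB]; exact ⟨hR, le_rfl⟩)
      linarith)
  have hy' := hmem y ⟨hχ.1.le.trans hy.1.le, hy.2.le⟩
  simp only at hyv
  rcases hy'.1.eq_or_lt with h0 | h0
  · rw [← h0, hg0] at hyv; linarith
  · have := hf.gfun_lower ⟨h0, hy'.2⟩
    linarith

theorem continuousOn_gfun {R : ℝ} {m ρ : ℝ → ℝ} (hm : ContinuousOn m (Icc 0 R))
    (hρ : ContinuousOn ρ (Icc 0 R)) (hρ1 : ∀ r ∈ Ioc 0 R, 1 ≤ ρ r) :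
    ContinuousOn (gfun m ρ) (Ioc 0 R) := by
  have hm := hm.mono Ioc_subset_Icc_self
  have hρ := hρ.mono Ioc_subset_Icc_self
  have hπ := pi_pos
  unfold gfun
  refine ContinuousOn.div ?_ ?_ ?_
  · refine ContinuousOn.sqrt (continuousOn_const.sub ?_)
    exact (continuousOn_const.mul hm).div continuousOn_id fun x hx => hx.1.ne'
  · exact ContinuousOn.mul (by fun_prop) (ContinuousOn.sqrt (by fun_prop))
  · intro x hx
    have h0 : 0 < x := hx.1
    have : 0 < √(2 * ρ x - 1) := sqrt_pos.2 (by linarith [hρ1 x hx])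
    positivity

/-- The integrand of the exponent in the weight of the quadratic form. -/
def weightRate (m ρ r₀ : ℝ → ℝ) (χ : ℝ) : ℝ := 1 / (4 * π * r₀ χ ^ 3 * gfun m ρ (r₀ χ))

/-- The exponential weight of the quadratic form. -/
def weight (m ρ r₀ : ℝ → ℝ) (χ : ℝ) : ℝ := Real.exp (∫ s in (0:ℝ)..χ, weightRate m ρ r₀ s)

theorem weight_pos (m ρ r₀ : ℝ → ℝ) (χ : ℝ) : 0 < weight m ρ r₀ χ := Real.exp_pos _

section Background

variable {R B : ℝ} {m ρ r₀ : ℝ → ℝ}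

theorem continuousOn_gfun_comp (h : IsComoving R B m ρ r₀)
    (hg : ContinuousOn (gfun m ρ) (Ioc 0 R)) (hmaps : MapsTo r₀ (Ioc 0 B) (Ioc 0 R)) :
    ContinuousOn (fun χ => gfun m ρ (r₀ χ)) (Ioc 0 B) :=
  hg.comp (h.2.2.2.1.mono Ioc_subset_Icc_self) hmaps

theorem continuousOn_weightRate (h : IsComoving R B m ρ r₀) (hf : NearFlat R m ρ)
    (hg : ContinuousOn (gfun m ρ) (Ioc 0 R)) (hmaps : MapsTo r₀ (Ioc 0 B) (Ioc 0 R)) :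
    ContinuousOn (weightRate m ρ r₀) (Ioc 0 B) := by
  have hr := h.2.2.2.1.mono Ioc_subset_Icc_self
  have hgc := continuousOn_gfun_comp h hg hmaps
  unfold weightRate
  refine ContinuousOn.div continuousOn_const (by fun_prop) fun χ hχ => ?_
  have h1 : 0 < r₀ χ := (hmaps hχ).1
  have h2 := hf.gfun_pos (hmaps hχ)
  have := pi_pos
  positivity

theorem intervalIntegrable_weightRate (h : IsComoving R B m ρ r₀) (hf : NearFlat R m ρ)
    (hg : ContinuousOn (gfun m ρ) (Ioc 0 R)) (hmaps : MapsTo r₀ (Ioc 0 B) (Ioc 0 R)) :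
    IntervalIntegrable (weightRate m ρ r₀) MeasureTheory.volume 0 B := by
  have hB : 0 < B := h.1
  have hπ := pi_pos
  have hsq : IntervalIntegrable (fun χ => 2 * r₀ χ * gfun m ρ (r₀ χ))
      MeasureTheory.volume 0 B := by
    refine intervalIntegral.intervalIntegrable_deriv_of_nonneg (g := fun χ => r₀ χ ^ 2) ?_ ?_ ?_
    · rw [uIcc_of_le hB.le]; exact h.2.2.2.1.pow 2
    · rw [min_eq_left hB.le, max_eq_right hB.le]
      intro χ hχ
      simpa using (h.2.2.2.2.2 χ ⟨hχ.1, hχ.2.le⟩).fun_pow 2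
    · rw [min_eq_left hB.le, max_eq_right hB.le]
      intro χ hχ
      have hχ' := hmaps ⟨hχ.1, hχ.2.le⟩
      have := hf.gfun_pos hχ'
      have := hχ'.1
      positivity
  refine (hsq.const_mul 8).mono_fun ?_ ?_
  · rw [uIoc_of_le hB.le]
    exact (continuousOn_weightRate h hf hg hmaps).aestronglyMeasurable measurableSet_Ioc
  · rw [uIoc_of_le hB.le]
    filter_upwards [MeasureTheory.ae_restrict_mem measurableSet_Ioc] with χ hχ
    have hχ' := hmaps hχ
    have hgp := hf.gfun_pos hχ'
    have hrp : 0 < r₀ χ := hχ'.1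
    have ha := (hf _ hχ').1.1
    unfold weightRate
    rw [Real.norm_of_nonneg (by positivity), Real.norm_of_nonneg (by positivity),
      div_le_iff₀ (by positivity)]
    have e : 8 * (2 * r₀ χ * gfun m ρ (r₀ χ)) * (4 * π * r₀ χ ^ 3 * gfun m ρ (r₀ χ))
        = (4 * π * r₀ χ ^ 2 * gfun m ρ (r₀ χ)) ^ 2 * (4 / π) := by
      field_simp; ring
    rw [e]
    have h4 : (5:ℝ) / 4 ≤ 4 / π := by
      rw [div_le_div_iff₀ (by norm_num) hπ]; linarith [pi_lt_d2]
    nlinarith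

theorem continuousOn_weight (h : IsComoving R B m ρ r₀) (hf : NearFlat R m ρ)
    (hg : ContinuousOn (gfun m ρ) (Ioc 0 R)) (hmaps : MapsTo r₀ (Ioc 0 B) (Ioc 0 R)) :
    ContinuousOn (weight m ρ r₀) (Icc 0 B) := by
  have hi := intervalIntegrable_weightRate h hf hg hmaps
  have := intervalIntegral.continuousOn_primitive_interval ((intervalIntegrable_iff' (by simp)).1 hi)
  rw [uIcc_of_le h.1.le] at this
  exact this.rexp

theorem hasDerivAt_weight (h : IsComoving R B m ρ r₀) (hf : NearFlat R m ρ)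
    (hg : ContinuousOn (gfun m ρ) (Ioc 0 R)) (hmaps : MapsTo r₀ (Ioc 0 B) (Ioc 0 R))
    {χ : ℝ} (hχ : χ ∈ Ioo 0 B) :
    HasDerivAt (weight m ρ r₀) (weight m ρ r₀ χ * weightRate m ρ r₀ χ) χ := by
  have hi := intervalIntegrable_weightRate h hf hg hmaps
  have hc := (continuousOn_weightRate h hf hg hmaps).mono Ioo_subset_Ioc_self
  refine (intervalIntegral.integral_hasDerivAt_right ?_
    (hc.stronglyMeasurableAtFilter isOpen_Ioo χ hχ)
    (hc.continuousAt (isOpen_Ioo.mem_nhds hχ))).exp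
  refine hi.mono_set ?_
  rw [uIcc_of_le hχ.1.le, uIcc_of_le h.1.le]
  exact Icc_subset_Icc le_rfl hχ.2.le

theorem exists_abs_le_radius (h : IsComoving R B m ρ r₀) (hR : 0 < R) (hf : NearFlat R m ρ)
    (hmaps : MapsTo r₀ (Ioc 0 B) (Ioc 0 R)) {u : ℝ → ℝ} (hu : C1On u (Icc 0 B))
    (hu0 : u 0 = 0) :
    ∃ L, 0 ≤ L ∧ ∀ χ ∈ Ioc 0 B,
      |u χ| ≤ L * r₀ χ ∧ |deriv u χ| ≤ L * gfun m ρ (r₀ χ) := by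
  obtain ⟨K, hK⟩ := isCompact_Icc.exists_bound_of_continuousOn hu.2
  have hπ := pi_pos
  have hc : 0 < 19 / 20 / (4 * π * R ^ 2) := by positivity
  set c := 19 / 20 / (4 * π * R ^ 2)
  have hK0 : 0 ≤ K := (norm_nonneg _).trans (hK 0 ⟨le_rfl, h.1.le⟩)
  have hder : ∀ χ ∈ Ioc 0 B, |deriv u χ| ≤ K / c * gfun m ρ (r₀ χ) := by
    intro χ hχ
    have h1 := hf.gfun_lower (hmaps hχ)
    calc |deriv u χ| ≤ K := hK χ ⟨hχ.1.le, hχ.2⟩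
      _ = K / c * c := by field_simp
      _ ≤ _ := by gcongr
  have hr := h.2.2.2.1
  have huc : ContinuousOn u (Icc 0 B) := fun x hx => (hu.1 x hx).continuousAt.continuousWithinAt
  have hmono : ∀ σ : ℝ, |σ| = 1 → MonotoneOn (fun χ => K / c * r₀ χ + σ * u χ) (Icc 0 B) := by
    intro σ hσ
    refine monotoneOn_of_hasDerivWithinAt_nonneg (convex_Icc 0 B)
      (f' := fun χ => K / c * gfun m ρ (r₀ χ) + σ * deriv u χ) (by fun_prop) ?_ ?_
    · rw [interior_Icc]
      intro χ hχ
      exact (((h.2.2.2.2.2 χ ⟨hχ.1, hχ.2.le⟩).const_mul _).add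
        ((hu.1 χ ⟨hχ.1.le, hχ.2.le⟩).hasDerivAt.const_mul _)).hasDerivWithinAt
    · rw [interior_Icc]
      intro χ hχ
      have h1 := hder χ ⟨hχ.1, hχ.2.le⟩
      have h2 : |σ * deriv u χ| = |deriv u χ| := by rw [abs_mul, hσ, one_mul]
      linarith [neg_abs_le (σ * deriv u χ)]
  refine ⟨K / c, by positivity, fun χ hχ => ⟨?_, hder χ hχ⟩⟩
  have h0 : (0:ℝ) ∈ Icc 0 B := ⟨le_rfl, h.1.le⟩
  have h1 := hmono 1 (by simp) h0 ⟨hχ.1.le, hχ.2⟩ hχ.1.le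
  have h2 := hmono (-1) (by simp) h0 ⟨hχ.1.le, hχ.2⟩ hχ.1.le
  simp only [h.2.1, hu0] at h1 h2
  exact abs_le.2 ⟨by linarith, by linarith⟩

/-- The derivative of `4π r₀ u² · weight`. -/
def flux (m ρ r₀ u : ℝ → ℝ) (χ : ℝ) : ℝ :=
  4 * π * (gfun m ρ (r₀ χ) * u χ ^ 2 + 2 * r₀ χ * u χ * deriv u χ
    + r₀ χ * u χ ^ 2 * weightRate m ρ r₀ χ) * weight m ρ r₀ χ

theorem hasDerivAt_flux (h : IsComoving R B m ρ r₀) (hf : NearFlat R m ρ)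
    (hg : ContinuousOn (gfun m ρ) (Ioc 0 R)) (hmaps : MapsTo r₀ (Ioc 0 B) (Ioc 0 R))
    {u : ℝ → ℝ} (hu : C1On u (Icc 0 B)) {χ : ℝ} (hχ : χ ∈ Ioo 0 B) :
    HasDerivAt (fun χ => 4 * π * (r₀ χ * u χ ^ 2) * weight m ρ r₀ χ) (flux m ρ r₀ u χ) χ := by
  have hr := h.2.2.2.2.2 χ ⟨hχ.1, hχ.2.le⟩
  have hu' := (hu.1 χ ⟨hχ.1.le, hχ.2.le⟩).hasDerivAt
  refine (((hr.fun_mul (hu'.fun_pow 2)).const_mul (4 * π)).fun_mul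
    (hasDerivAt_weight h hf hg hmaps hχ)).congr_deriv ?_
  unfold flux
  push_cast
  ring

/-- Squared size of a perturbation, with `u` measured relative to the radius and `u′` relative to
`∂_χ r₀`. -/
def pertSq (m ρ r₀ u v : ℝ → ℝ) (χ : ℝ) : ℝ :=
  (u χ / r₀ χ) ^ 2 + (deriv u χ / gfun m ρ (r₀ χ)) ^ 2 + v χ ^ 2

theorem Qint_bounds (hf : NearFlat R m ρ) (hmaps : MapsTo r₀ (Ioc 0 B) (Ioc 0 R))
    (u v : ℝ → ℝ) {χ : ℝ} (hχ : χ ∈ Ioc 0 B) :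
    pertSq m ρ r₀ u v χ / 4 * weight m ρ r₀ χ ≤ Qint m ρ r₀ u v χ - flux m ρ r₀ u χ ∧
    |Qint m ρ r₀ u v χ| ≤ 20 * pertSq m ρ r₀ u v χ * weight m ρ r₀ χ ∧
    |flux m ρ r₀ u χ| ≤ 20 * pertSq m ρ r₀ u v χ * weight m ρ r₀ χ := by
  have hχ' := hmaps hχ
  have hgp := hf.gfun_pos hχ'
  have hge := NearFlat.gfun_eq (m := m) (ρ := ρ) hχ'
  obtain ⟨⟨ha, ha1⟩, ⟨hρ, hρ1⟩, ⟨hμ, hμ1⟩, hq1⟩ := hf _ hχ'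
  have hrp : 0 < r₀ χ := hχ'.1
  have hπ := pi_pos
  have hw := weight_pos m ρ r₀ χ
  have hQ : Qint m ρ r₀ u v χ = _ * weight m ρ r₀ χ := rfl
  have hF : flux m ρ r₀ u χ = _ * weight m ρ r₀ χ := rfl
  rw [hQ, hF]
  unfold weightRate pertSq
  generalize weight m ρ r₀ χ = E at *
  generalize gfun m ρ (r₀ χ) = g at *
  generalize r₀ χ = r at *
  generalize hx : u χ / r = x
  generalize hwd : deriv u χ / g = w
  generalize hμd : m r / r = μ at *
  rw [div_eq_iff hrp.ne'] at hx hμd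
  rw [div_eq_iff hgp.ne'] at hwd
  rw [hx, hwd, hμd]
  have ha0 : 0 < 4 * π * r ^ 2 * g := by positivity
  rw [bracket_eq (ρ r) r _ μ x w (v χ) g hrp ha0 hge, flux_eq r _ x w g hrp ha0 hge]
  generalize 4 * π * r ^ 2 * g = a at *
  obtain ⟨c1, c2, c3, c4, c5, c6, c7, c8, c9, c10⟩ :=
    coeff_bounds (ρ r) a μ (4 * π * r ^ 2) ha ha1 hρ hρ1 hμ hμ1 (by positivity) hq1
  refine ⟨?_, ?_, ?_⟩
  · rw [← sub_mul]
    refine mul_le_mul_of_nonneg_right ?_ hw.le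
    refine (quad_lower _ _ _ _ x w (v χ) c1 c2 c3 c4).trans_eq ?_
    ring
  · rw [abs_mul, abs_of_pos hw]
    refine mul_le_mul_of_nonneg_right ?_ hw.le
    exact (quad_abs_le _ _ _ _ 10 x w (v χ) c5 c6 c7 c8).trans_eq (by ring)
  · rw [abs_mul, abs_of_pos hw]
    refine mul_le_mul_of_nonneg_right ?_ hw.le
    have := quad_abs_le _ _ 0 0 10 x w (v χ) c9 c10 (by norm_num) (by norm_num)
    simp only [zero_mul, add_zero] at this
    exact this.trans_eq (by ring)

theorem exists_pertSq_weight_le (h : IsComoving R B m ρ r₀) (hR : 0 < R) (hf : NearFlat R m ρ)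
    (hg : ContinuousOn (gfun m ρ) (Ioc 0 R)) (hmaps : MapsTo r₀ (Ioc 0 B) (Ioc 0 R))
    {u v : ℝ → ℝ} (hu : C1On u (Icc 0 B)) (hu0 : u 0 = 0) (hv : ContinuousOn v (Icc 0 B)) :
    ∃ M, ∀ χ ∈ Ioc 0 B, 20 * pertSq m ρ r₀ u v χ * weight m ρ r₀ χ ≤ M := by
  obtain ⟨L, hL0, hL⟩ := exists_abs_le_radius h hR hf hmaps hu hu0
  obtain ⟨V, hV⟩ := isCompact_Icc.exists_bound_of_continuousOn hv
  obtain ⟨W, hW⟩ := isCompact_Icc.exists_bound_of_continuousOn (continuousOn_weight h hf hg hmaps)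
  refine ⟨20 * (L ^ 2 + L ^ 2 + V ^ 2) * W, fun χ hχ => ?_⟩
  have hχ' := hmaps hχ
  have hgp := hf.gfun_pos hχ'
  have hrp : 0 < r₀ χ := hχ'.1
  obtain ⟨h1, h2⟩ := hL χ hχ
  have h3 := hV χ ⟨hχ.1.le, hχ.2⟩
  have h4 := (le_abs_self _).trans (hW χ ⟨hχ.1.le, hχ.2⟩)
  have hw := weight_pos m ρ r₀ χ
  unfold pertSq
  gcongr ?_ * ?_
  · gcongr 20 * (?_ + ?_ + ?_)
    · refine sq_le_sq' ?_ ?_ <;> [rw [le_div_iff₀ hrp]; rw [div_le_iff₀ hrp]] <;>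
        linarith [abs_le.1 h1]
    · refine sq_le_sq' ?_ ?_ <;> [rw [le_div_iff₀ hgp]; rw [div_le_iff₀ hgp]] <;>
        linarith [abs_le.1 h2]
    · exact sq_le_sq' (abs_le.1 h3).1 (abs_le.1 h3).2

theorem continuousOn_flux (h : IsComoving R B m ρ r₀) (hf : NearFlat R m ρ)
    (hg : ContinuousOn (gfun m ρ) (Ioc 0 R)) (hmaps : MapsTo r₀ (Ioc 0 B) (Ioc 0 R))
    {u : ℝ → ℝ} (hu : C1On u (Icc 0 B)) : ContinuousOn (flux m ρ r₀ u) (Ioc 0 B) := by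
  have hr := h.2.2.2.1.mono Ioc_subset_Icc_self
  have hgc := continuousOn_gfun_comp h hg hmaps
  have hwr := continuousOn_weightRate h hf hg hmaps
  have hw := (continuousOn_weight h hf hg hmaps).mono Ioc_subset_Icc_self
  have huc : ContinuousOn u (Ioc 0 B) := fun x hx =>
    (hu.1 x (Ioc_subset_Icc_self hx)).continuousAt.continuousWithinAt
  have hu' := hu.2.mono Ioc_subset_Icc_self
  unfold flux
  fun_prop

theorem continuousOn_Qint (h : IsComoving R B m ρ r₀) (hf : NearFlat R m ρ)
    (hm : ContinuousOn m (Icc 0 R)) (hρ : ContinuousOn ρ (Icc 0 R))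
    (hg : ContinuousOn (gfun m ρ) (Ioc 0 R)) (hmaps : MapsTo r₀ (Ioc 0 B) (Ioc 0 R))
    {u v : ℝ → ℝ} (hu : C1On u (Icc 0 B)) (hv : ContinuousOn v (Icc 0 B)) :
    ContinuousOn (Qint m ρ r₀ u v) (Ioc 0 B) := by
  have hr := h.2.2.2.1.mono Ioc_subset_Icc_self
  have hgc := continuousOn_gfun_comp h hg hmaps
  have hw := (continuousOn_weight h hf hg hmaps).mono Ioc_subset_Icc_self
  have huc : ContinuousOn u (Ioc 0 B) := fun x hx =>
    (hu.1 x (Ioc_subset_Icc_self hx)).continuousAt.continuousWithinAt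
  have hu' := hu.2.mono Ioc_subset_Icc_self
  have hv := hv.mono Ioc_subset_Icc_self
  have hmc : ContinuousOn (fun χ => m (r₀ χ)) (Ioc 0 B) :=
    (hm.mono Ioc_subset_Icc_self).comp hr hmaps
  have hρc : ContinuousOn (fun χ => ρ (r₀ χ)) (Ioc 0 B) :=
    (hρ.mono Ioc_subset_Icc_self).comp hr hmaps
  have hr0 : ∀ χ ∈ Ioc 0 B, r₀ χ ≠ 0 := fun χ hχ => (hmaps hχ).1.ne'
  have hg0 : ∀ χ ∈ Ioc 0 B, gfun m ρ (r₀ χ) ≠ 0 := fun χ hχ => (hf.gfun_pos (hmaps hχ)).ne'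
  have hdiv : ∀ (f : ℝ → ℝ) (c : ℝ) (i j : ℕ), c ≠ 0 → ContinuousOn f (Ioc 0 B) →
      ContinuousOn (fun χ => f χ / (c * r₀ χ ^ i * gfun m ρ (r₀ χ) ^ j)) (Ioc 0 B) := by
    intro f c i j hc hfc
    refine hfc.div (by fun_prop) fun χ hχ => ?_
    have := hr0 χ hχ
    have := hg0 χ hχ
    positivity
  have hP : ContinuousOn (fun χ => 1 - 2 * m (r₀ χ) / r₀ χ) (Ioc 0 B) :=
    continuousOn_const.sub ((continuousOn_const.mul hmc).div hr hr0)
  have hN : ContinuousOn (fun χ => 4 * π * r₀ χ * (ρ (r₀ χ) - 1) + m (r₀ χ) / r₀ χ ^ 2)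
      (Ioc 0 B) := by
    refine ContinuousOn.add ?_ (hmc.div (hr.pow 2) fun χ hχ => pow_ne_zero 2 (hr0 χ hχ))
    exact (continuousOn_const.mul hr).mul (hρc.sub continuousOn_const)
  have h4 : 4 * π ≠ 0 := by positivity
  have d1 := hdiv _ _ 3 1 h4 hN
  have d2 := hdiv _ _ 4 1 h4 hP
  have d3 := hdiv _ _ 2 2 h4 hN
  have d4 := hdiv _ _ 2 3 h4 hP
  have d5 := hdiv (fun χ => 2 * ρ (r₀ χ) - 1) _ 2 1 h4
    ((continuousOn_const.mul hρc).sub continuousOn_const)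
  simp only [pow_one] at d1 d2 d5
  refine ContinuousOn.mul ?_ hw
  refine ((((((ContinuousOn.add ?_ ?_).sub ((continuousOn_const.mul d1).mul (huc.pow 2))).add
    ((continuousOn_const.mul d2).mul (huc.pow 2))).sub
    (((continuousOn_const.mul d3).mul huc).mul hu')).add (d4.mul (hu'.pow 2))).add
    (d5.mul (hv.pow 2)))
  · exact ((continuousOn_const.mul hρc).mul hgc).mul (huc.pow 2)
  · exact (((continuousOn_const.mul hr).mul hρc).mul huc).mul hu'

theorem intervalIntegrable_of_bound_Ioc {f : ℝ → ℝ} {b M : ℝ} (hb : 0 ≤ b)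
    (hc : ContinuousOn f (Ioc 0 b)) (hM : ∀ x ∈ Ioc 0 b, |f x| ≤ M) :
    IntervalIntegrable f MeasureTheory.volume 0 b := by
  rw [intervalIntegrable_iff_integrableOn_Ioc_of_le hb]
  refine MeasureTheory.IntegrableOn.of_bound measure_Ioc_lt_top
    (hc.aestronglyMeasurable measurableSet_Ioc) M ?_
  filter_upwards [MeasureTheory.ae_restrict_mem measurableSet_Ioc] with x hx using hM x hx

end Background

theorem Qform_eq_zero_of_eqOn {m ρ r₀ u v : ℝ → ℝ} {B : ℝ} (hB : 0 ≤ B)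
    (hu : ∀ χ ∈ Icc 0 B, u χ = 0) (hv : ∀ χ ∈ Icc 0 B, v χ = 0) : Qform m ρ r₀ B u v = 0 := by
  unfold Qform
  rw [intervalIntegral.integral_of_le hB, MeasureTheory.integral_Ioc_eq_integral_Ioo]
  refine MeasureTheory.setIntegral_eq_zero_of_forall_eq_zero fun χ hχ => ?_
  have h1 : deriv u χ = 0 := by
    have : u =ᶠ[nhds χ] fun _ => 0 := by
      filter_upwards [isOpen_Ioo.mem_nhds hχ] with y hy using hu y (Ioo_subset_Icc_self hy)
    rw [this.deriv_eq, deriv_const]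
  simp [Qint, h1, hu χ (Ioo_subset_Icc_self hχ), hv χ (Ioo_subset_Icc_self hχ)]

/-- Small static hard stars are local minima of the mass-energy functional:
the second-variation quadratic form is nonnegative, and vanishes only for the
trivial perturbation. -/
theorem stmt7 :
    ∀ Cs > (0:ℝ), ∃ R₀ > (0:ℝ), ∀ (R B : ℝ) (m ρ r₀ : ℝ → ℝ),
      IsSmallStar Cs R m ρ → R < R₀ → IsComoving R B m ρ r₀ →
      ∀ u v : ℝ → ℝ, C1On u (Icc 0 B) → u 0 = 0 → ContinuousOn v (Icc 0 B) →
        0 ≤ Qform m ρ r₀ B u v ∧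
        (Qform m ρ r₀ B u v = 0 ↔
          (∀ χ ∈ Icc (0:ℝ) B, u χ = 0) ∧ ∀ χ ∈ Icc (0:ℝ) B, v χ = 0) := by
  intro C hC
  refine ⟨1 / (50 + 100 * C), by positivity, fun R B m ρ r₀ hs hRlt h u v hu hu0 hv => ?_⟩
  rw [lt_div_iff₀ (by positivity)] at hRlt
  have hR : 0 < R := hs.1
  have hB : 0 < B := h.1
  have hf := hs.nearFlat hC hRlt
  have hg := continuousOn_gfun hs.2.1 hs.2.2.1 fun r hr => (hf r hr).2.1.1
  have hmaps := h.mapsTo hR hf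
  have hπ := pi_pos
  obtain ⟨M, hM⟩ := exists_pertSq_weight_le h hR hf hg hmaps hu hu0 hv
  have hb := fun χ (hχ : χ ∈ Ioc 0 B) => Qint_bounds hf hmaps u v hχ
  have hQc := continuousOn_Qint h hf hs.2.1 hs.2.2.1 hg hmaps hu hv
  have hFc := continuousOn_flux h hf hg hmaps hu
  have hQi := intervalIntegrable_of_bound_Ioc hB.le hQc
    fun χ hχ => (hb χ hχ).2.1.trans (hM χ hχ)
  have hFi := intervalIntegrable_of_bound_Ioc hB.le hFc
    fun χ hχ => (hb χ hχ).2.2.trans (hM χ hχ)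
  have huc : ContinuousOn u (Icc 0 B) := fun x hx => (hu.1 x hx).continuousAt.continuousWithinAt
  have hF0 : 0 ≤ ∫ χ in (0:ℝ)..B, flux m ρ r₀ u χ := by
    have hrc := h.2.2.2.1
    have hwc := continuousOn_weight h hf hg hmaps
    rw [intervalIntegral.integral_eq_sub_of_hasDerivAt_of_le hB.le (by fun_prop)
      (fun χ hχ => hasDerivAt_flux h hf hg hmaps hu hχ) hFi]
    have := weight_pos m ρ r₀ B
    simp only [h.2.1, h.2.2.1, hu0]
    simp only [ne_eq, OfNat.ofNat_ne_zero, not_false_eq_true, zero_pow, mul_zero, zero_mul,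
      sub_zero]
    positivity
  have hpert : ∀ χ, 0 ≤ pertSq m ρ r₀ u v χ := fun χ => by unfold pertSq; positivity
  have hnn : ∀ χ ∈ Ioc 0 B, 0 ≤ Qint m ρ r₀ u v χ - flux m ρ r₀ u χ := fun χ hχ =>
    (mul_nonneg (div_nonneg (hpert χ) (by norm_num)) (weight_pos m ρ r₀ χ).le).trans (hb χ hχ).1
  have hdi := hQi.sub hFi
  have hsub : ∫ χ in (0:ℝ)..B, (Qint m ρ r₀ u v χ - flux m ρ r₀ u χ) =
      Qform m ρ r₀ B u v - ∫ χ in (0:ℝ)..B, flux m ρ r₀ u χ :=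
    intervalIntegral.integral_sub hQi hFi
  have hd0 : 0 ≤ ∫ χ in (0:ℝ)..B, (Qint m ρ r₀ u v χ - flux m ρ r₀ u χ) := by
    rw [intervalIntegral.integral_of_le hB.le]
    exact MeasureTheory.setIntegral_nonneg measurableSet_Ioc hnn
  refine ⟨by linarith, fun hQ0 => ?_, fun hz => Qform_eq_zero_of_eqOn hB.le hz.1 hz.2⟩
  have hz : ∫ χ in (0:ℝ)..B, (Qint m ρ r₀ u v χ - flux m ρ r₀ u χ) = 0 := by linarith
  rw [intervalIntegral.integral_of_le hB.le, MeasureTheory.setIntegral_eq_zero_iff_of_nonneg_ae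
    (by filter_upwards [MeasureTheory.ae_restrict_mem measurableSet_Ioc] with χ hχ using hnn χ hχ)
    ((intervalIntegrable_iff_integrableOn_Ioc_of_le hB.le).1 hdi)] at hz
  have heq := MeasureTheory.Measure.eqOn_Ioc_of_ae_eq _ hz (hQc.sub hFc) continuousOn_const
  have huv : ∀ χ ∈ Ioc 0 B, u χ = 0 ∧ v χ = 0 := by
    intro χ hχ
    have h1 := (hb χ hχ).1
    have h2 : Qint m ρ r₀ u v χ - flux m ρ r₀ u χ = 0 := heq hχ
    have hrp : r₀ χ ≠ 0 := (hmaps hχ).1.ne'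
    have h3 : pertSq m ρ r₀ u v χ ≤ 0 := by
      by_contra! h3
      have := weight_pos m ρ r₀ χ
      have : 0 < pertSq m ρ r₀ u v χ / 4 * weight m ρ r₀ χ := by positivity
      linarith
    unfold pertSq at h3
    have a1 := sq_nonneg (u χ / r₀ χ)
    have a2 := sq_nonneg (deriv u χ / gfun m ρ (r₀ χ))
    have a3 := sq_nonneg (v χ)
    have b1 : u χ / r₀ χ = 0 := pow_eq_zero_iff two_ne_zero |>.1 (by linarith)
    exact ⟨(div_eq_zero_iff.1 b1).resolve_right hrp, pow_eq_zero_iff two_ne_zero |>.1 (by linarith)⟩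
  have hcl : closure (Ioc 0 B) = Icc 0 B := closure_Ioc hB.ne
  have extend : ∀ f : ℝ → ℝ, ContinuousOn f (Icc 0 B) → (∀ χ ∈ Ioc 0 B, f χ = 0) →
      ∀ χ ∈ Icc 0 B, f χ = 0 := fun f hfc hf0 χ hχ =>
    EqOn.of_subset_closure (g := fun _ => (0:ℝ)) hf0 hfc continuousOn_const
      Ioc_subset_Icc_self hcl.ge hχ
  exact ⟨extend u huc fun χ hχ => (huv χ hχ).1, extend v hv fun χ hχ => (huv χ hχ).2⟩

end
end

section
/- There exist R₀ > 0 and, for each ε ∈ [0,1/2], a constant C_ε > 0 such that for every small-hard-star background (r₀, m₀, ρ₀) in comoving coordinates on [0,B] with surface radius R = r₀(B) < R₀, every u ∈ C¹([0,B]) with u(0) = 0, and every continuous v : [0,B] → ℝ, the first variation of the mass aspect function, given pointwise by (m/r^{1+ε})˙(χ) = −4π r₀(χ)^{1−ε}(ρ₀(χ) − 1)·u(χ) − (1+ε)·(m₀(χ)/r₀(χ)^{2+ε})·u(χ), satisfies the pointwise bound [(m/r^{1+ε})˙(χ)]² ≤ C_ε · r₀(χ)^{1/2−ε} · Q[u,v]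 for all χ ∈ [0,B]. -/
open Real Set Filter

noncomputable section

/-- The pointwise bounds on the background quantities `r`, `M = m(r)`, `p = ρ(r)` and the
comoving derivative `g` which hold throughout a sufficiently small star. -/
structure SmallBackground (r M p g : ℝ) : Prop where
  r_pos : 0 < r
  r_small : 4 * π * r ^ 2 ≤ 1 / 100
  one_le_p : 1 ≤ p
  p_le : p ≤ 1 + 1 / 100
  M_nonneg : 0 ≤ M
  M_le : M ≤ r / 100
  M_le_cube : M ≤ 9 * r ^ 3
  g_pos : 0 < g
  g_sq : g ^ 2 * (16 * π ^ 2 * r ^ 4 * (2 * p - 1)) = 1 - 2 * M / r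

/-- The density of the second variation, without its exponential weight. -/
def secondVariationDensity (r M p g a d v : ℝ) : ℝ :=
  8 * π * p * g * a ^ 2
    + 16 * π * r * p * a * d
    - 6 * ((4 * π * r * (p - 1) + M / r ^ 2) / (4 * π * r ^ 3 * g)) * a ^ 2
    + 2 * ((1 - 2 * M / r) / (4 * π * r ^ 4 * g)) * a ^ 2
    - 2 * ((4 * π * r * (p - 1) + M / r ^ 2) / (4 * π * r ^ 2 * g ^ 2)) * a * d
    + ((1 - 2 * M / r) / (4 * π * r ^ 2 * g ^ 3)) * d ^ 2
    + ((2 * p - 1) / (4 * π * r ^ 2 * g)) * v ^ 2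

lemma aemeasurable_secondVariationDensity {μ : MeasureTheory.Measure ℝ}
    {r M p g a d v : ℝ → ℝ} (hr : AEMeasurable r μ) (hM : AEMeasurable M μ)
    (hp : AEMeasurable p μ) (hg : AEMeasurable g μ) (ha : AEMeasurable a μ)
    (hd : AEMeasurable d μ) (hv : AEMeasurable v μ) :
    AEMeasurable (fun χ => secondVariationDensity (r χ) (M χ) (p χ) (g χ) (a χ) (d χ) (v χ))
      μ := by
  unfold secondVariationDensity
  fun_prop

namespace SmallBackground

variable {r M p g : ℝ}

lemma r_le_one (h : SmallBackground r M p g) : r ≤ 1 / 20 := by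
  have := h.r_pos
  have := h.r_small
  have := Real.pi_gt_three
  nlinarith [sq_nonneg r]

lemma compactness_mem (h : SmallBackground r M p g) :
    1 - 2 * M / r ∈ Icc (98 / 100 : ℝ) 1 := by
  have hr := h.r_pos
  have h1 : M / r ≤ 1 / 100 := by
    rw [div_le_iff₀ hr]; linarith [h.M_le]
  have h2 : 0 ≤ M / r := div_nonneg h.M_nonneg hr.le
  rw [mul_div_assoc]
  constructor <;> linarith

/-- The relative derivative `r ∂_r` of the weight exponent is small. -/
lemma weight_mem (h : SmallBackground r M p g) :
    1 / (4 * π * r ^ 2 * g ^ 2) ∈ Icc (0 : ℝ) (2 / 100) := by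
  have hr := h.r_pos
  have hg := h.g_pos
  have hπ := Real.pi_pos
  obtain ⟨hX, -⟩ := h.compactness_mem
  refine ⟨by positivity, ?_⟩
  rw [div_le_iff₀ (by positivity)]
  have e := h.g_sq
  have h1 := h.r_small
  have h2 := h.p_le
  have h3 := h.one_le_p
  set z := 4 * π * r ^ 2 * g ^ 2 with hz
  have hz0 : 0 < z := by positivity
  have e' : z * (4 * π * r ^ 2) * (2 * p - 1) = 1 - 2 * M / r := by rw [← e, hz]; ring
  have h4 : z * (4 * π * r ^ 2) * (2 * p - 1) ≤ z * (1 / 100) * (102 / 100) := by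
    gcongr
    · nlinarith
    · linarith
  nlinarith

lemma one_le_g (h : SmallBackground r M p g) : 1 ≤ g := by
  obtain ⟨-, h1⟩ := h.weight_mem
  have hr := h.r_pos
  have hg := h.g_pos
  have hπ := Real.pi_pos
  rw [div_le_iff₀ (by positivity)] at h1
  have h2 : 4 * π * r ^ 2 * g ^ 2 ≤ 1 / 100 * g ^ 2 := by gcongr; exact h.r_small
  nlinarith

lemma weight_le_g (h : SmallBackground r M p g) : 1 / (4 * π * r ^ 3 * g) ≤ g := by
  have hr := h.r_pos
  have hg := h.g_pos
  have hπ := Real.pi_pos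
  obtain ⟨hX, -⟩ := h.compactness_mem
  rw [div_le_iff₀ (by positivity)]
  have e := h.g_sq
  have h2 := h.p_le
  have h3 := h.one_le_p
  have h4 : 4 * π * r ≤ 1 / 2 := by
    have := h.r_le_one
    have := Real.pi_lt_d2
    have := h.r_small
    by_contra! hc
    nlinarith
  set z := g * (4 * π * r ^ 3 * g) with hz
  have hz0 : 0 < z := by positivity
  have e' : z * (4 * π * r) * (2 * p - 1) = 1 - 2 * M / r := by rw [← e, hz]; ring
  have h4 : z * (4 * π * r) * (2 * p - 1) ≤ z * (1 / 2) * (102 / 100) := by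
    gcongr
    · nlinarith
    · linarith
  nlinarith

/-- The density in terms of the areal-radius derivative `b = r ∂_r u`. -/
lemma exists_density_eq (h : SmallBackground r M p g) :
    ∃ δ ∈ Icc (0 : ℝ) (2 / 100), ∀ a d v : ℝ, secondVariationDensity r M p g a d v =
      2 * π * g * ((4 * p + 4 * (2 * p - 1) - 12 * δ) * a ^ 2
        + (8 * p - 4 * δ) * (a * (r * d / g)) + 2 * (2 * p - 1) * (r * d / g) ^ 2)
      + g * (2 * p - 1) * (1 / (4 * π * r ^ 2 * g ^ 2)) * v ^ 2 := by
  have hr := h.r_pos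
  have hg := h.g_pos
  have hπ := Real.pi_pos
  obtain ⟨hX, hX1⟩ := h.compactness_mem
  have hY := h.one_le_p
  have hY' := h.p_le
  have hX0 : 0 < 1 - 2 * M / r := by linarith
  have hM : M / r ≤ 1 / 100 := by
    rw [div_le_iff₀ hr]; linarith [h.M_le]
  have hM0 : 0 ≤ M / r := div_nonneg h.M_nonneg hr.le
  refine ⟨(4 * π * r ^ 2 * (p - 1) + M / r) * (2 * p - 1) / (1 - 2 * M / r), ⟨?_, ?_⟩, ?_⟩
  · have : 0 ≤ p - 1 := by linarith
    have : 0 ≤ 2 * p - 1 := by linarith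
    positivity
  · rw [div_le_iff₀ hX0]
    have h1 : 4 * π * r ^ 2 * (p - 1) ≤ 1 / 100 * (1 / 100) := by
      gcongr
      · exact h.r_small
      · linarith
    have h2 : (4 * π * r ^ 2 * (p - 1) + M / r) * (2 * p - 1)
        ≤ (1 / 100 * (1 / 100) + 1 / 100) * (102 / 100) := by
      gcongr
      · linarith
      · linarith
    linarith
  · intro a d v
    have hY0 : (2 * p - 1) ≠ 0 := by linarith
    rw [← h.g_sq, secondVariationDensity, ← h.g_sq]
    obtain ⟨y, rfl⟩ : ∃ y, p = (y + 1) / 2 := ⟨2 * p - 1, by ring⟩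
    rw [show 2 * ((y + 1) / 2) - 1 = y by ring] at *
    field_simp
    ring

/-- Up to a lower order term, the density dominates the derivative of the boundary term
`r u²` with either of two different factors. -/
lemma le_density (h : SmallBackground r M p g) {κ : ℝ} (hκ : κ ∈ Icc (4 : ℝ) 5) (a d v : ℝ) :
    2 * π * κ * (g * a ^ 2 + 2 * r * a * d + r * a ^ 2 * (1 / (4 * π * r ^ 3 * g)))
      ≤ secondVariationDensity r M p g a d v := by
  have hr := h.r_pos
  have hg := h.g_pos
  have hπ := Real.pi_pos
  obtain ⟨δ, ⟨hδ0, hδ⟩, e⟩ := h.exists_density_eq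
  obtain ⟨hθ0, hθ⟩ := h.weight_mem
  have hY := h.one_le_p
  have hY' := h.p_le
  obtain ⟨hκ1, hκ2⟩ := hκ
  have e2 : g * a ^ 2 + 2 * r * a * d + r * a ^ 2 * (1 / (4 * π * r ^ 3 * g)) =
      g * (a ^ 2 + 2 * (a * (r * d / g)) + 1 / (4 * π * r ^ 2 * g ^ 2) * a ^ 2) := by
    field_simp
  rw [e, e2]
  set b := r * d / g
  set θ := 1 / (4 * π * r ^ 2 * g ^ 2)
  have hv : 0 ≤ g * (2 * p - 1) * θ * v ^ 2 := by
    have : 0 ≤ 2 * p - 1 := by linarith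
    positivity
  have hq : κ * (a ^ 2 + 2 * (a * b) + θ * a ^ 2) ≤
      (4 * p + 4 * (2 * p - 1) - 12 * δ) * a ^ 2
        + (8 * p - 4 * δ) * (a * b) + 2 * (2 * p - 1) * b ^ 2 := by
    have hA : 0 ≤ (4 * p + 4 * (2 * p - 1) - 12 * δ - κ * (1 + θ) - 5 / 2) * a ^ 2 := by
      apply mul_nonneg _ (sq_nonneg a)
      nlinarith
    have hB : 0 ≤ (2 * (2 * p - 1) - 2) * b ^ 2 :=
      mul_nonneg (by linarith) (sq_nonneg b)
    have hC : |(8 * p - 4 * δ - 2 * κ) * (a * b)| ≤ 21 / 10 * |a * b| := by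
      rw [abs_mul]
      gcongr
      rw [abs_le]
      constructor <;> linarith
    have hD : |a * b| ≤ (a ^ 2 + b ^ 2) / 2 := by
      rw [abs_le]
      constructor <;> nlinarith [sq_nonneg (a + b), sq_nonneg (a - b)]
    nlinarith [(abs_le.1 hC).1, sq_nonneg a, sq_nonneg b]
  have h1 := mul_le_mul_of_nonneg_left hq (by positivity : 0 ≤ 2 * π * g)
  linarith

lemma abs_density_le (h : SmallBackground r M p g) {a d v A : ℝ}
    (ha : |a| ≤ A) (hd : |d| ≤ A) (hv : |v| ≤ A) :
    |secondVariationDensity r M p g a d v| ≤ 200 * A ^ 2 * g := by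
  have hr := h.r_pos
  have hg := h.g_pos
  have hπ := Real.pi_pos
  have hπ4 := Real.pi_lt_four
  obtain ⟨δ, ⟨hδ0, hδ⟩, e⟩ := h.exists_density_eq
  obtain ⟨hθ0, hθ⟩ := h.weight_mem
  have hY := h.one_le_p
  have hY' := h.p_le
  have hA : 0 ≤ A := (abs_nonneg a).trans ha
  rw [e]
  have hb : |r * d / g| ≤ A := by
    rw [abs_div, abs_mul, abs_of_pos hr, abs_of_pos hg, div_le_iff₀ hg]
    have : r * |d| ≤ 1 * A := by
      gcongr
      linarith [h.r_le_one]
    nlinarith [h.one_le_g]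
  set b := r * d / g
  set θ := 1 / (4 * π * r ^ 2 * g ^ 2)
  have ha2 : a ^ 2 ≤ A ^ 2 := sq_le_sq' (abs_le.1 ha).1 (abs_le.1 ha).2
  have hb2 : b ^ 2 ≤ A ^ 2 := sq_le_sq' (abs_le.1 hb).1 (abs_le.1 hb).2
  have hv2 : v ^ 2 ≤ A ^ 2 := sq_le_sq' (abs_le.1 hv).1 (abs_le.1 hv).2
  have hab : |a * b| ≤ A ^ 2 := by
    rw [abs_mul, pow_two]; gcongr
  have h1 : |(4 * p + 4 * (2 * p - 1) - 12 * δ) * a ^ 2| ≤ 9 * A ^ 2 := by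
    rw [abs_mul, abs_of_nonneg (sq_nonneg a)]
    gcongr
    rw [abs_le]; constructor <;> linarith
  have h2 : |(8 * p - 4 * δ) * (a * b)| ≤ 9 * A ^ 2 := by
    rw [abs_mul]
    gcongr
    rw [abs_le]; constructor <;> linarith
  have h3 : |2 * (2 * p - 1) * b ^ 2| ≤ 3 * A ^ 2 := by
    rw [abs_mul, abs_of_nonneg (sq_nonneg b)]
    gcongr
    rw [abs_le]; constructor <;> linarith
  have h4 : |(2 * p - 1) * θ * v ^ 2| ≤ 1 * A ^ 2 := by
    rw [abs_mul, abs_of_nonneg (sq_nonneg v)]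
    gcongr
    rw [abs_le]; constructor <;> nlinarith
  set S := (4 * p + 4 * (2 * p - 1) - 12 * δ) * a ^ 2
        + (8 * p - 4 * δ) * (a * b) + 2 * (2 * p - 1) * b ^ 2 with hS
  have h5 : |S| ≤ 21 * A ^ 2 := by
    rw [abs_le] at *
    constructor <;> linarith
  have h6 : |2 * π * S| ≤ 8 * (21 * A ^ 2) := by
    rw [abs_mul, abs_of_pos (by positivity : 0 < 2 * π)]
    gcongr
    linarith
  have e3 : 2 * π * g * S + g * (2 * p - 1) * θ * v ^ 2 =
      (2 * π * S + (2 * p - 1) * θ * v ^ 2) * g := by ring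
  rw [e3, abs_mul, abs_of_pos hg]
  gcongr
  rw [abs_le] at *
  constructor <;> nlinarith

end SmallBackground

lemma IsSmallStar.smallBackground {C R : ℝ} {m ρ : ℝ → ℝ} (hC : 0 < C)
    (hs : IsSmallStar C R m ρ) (hR : R < 1 / (40 * (1 + C))) {r : ℝ} (hr : r ∈ Ioc 0 R) :
    SmallBackground r (m r) (ρ r) (gfun m ρ r) := by
  obtain ⟨hR0, -, -, -, -, -, hb⟩ := hs
  obtain ⟨h1, h2, h3, h4⟩ := hb r hr
  obtain ⟨hr0, hrR⟩ := hr
  have hπ := Real.pi_pos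
  have hπ3 := Real.pi_gt_three
  have hπ2 := Real.pi_lt_d2
  rw [lt_div_iff₀ (by positivity)] at hR
  have hR1 : R < 1 / 40 := by nlinarith
  have hCR : C * R ^ 2 ≤ 1 / 100 := by nlinarith
  have hr1 : 4 * π * r ^ 2 ≤ 1 / 100 := by
    have : r ^ 2 ≤ (1 / 40) ^ 2 := by gcongr; linarith
    nlinarith
  have hm0 : 0 < m r / r ^ 3 := by
    by_contra! hc
    have : 3 / (4 * π) * (m r / r ^ 3) ≤ 0 := mul_nonpos_of_nonneg_of_nonpos (by positivity) hc
    linarith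
  have hmpos : 0 < m r := by
    have := mul_pos hm0 (pow_pos hr0 3)
    rwa [div_mul_cancel₀ _ (by positivity)] at this
  have hm1 : 3 * m r ≤ 101 / 100 * (4 * π * r ^ 3) := by
    have e : 3 / (4 * π) * (m r / r ^ 3) = 3 * m r / (4 * π * r ^ 3) := by
      field_simp
    rw [e, div_le_iff₀ (by positivity)] at h4
    have : (1 + C * R ^ 2) * (4 * π * r ^ 3) ≤ (101 / 100) * (4 * π * r ^ 3) := by
      gcongr; linarith
    linarith
  have hmr : m r ≤ r / 100 := by nlinarith
  have hX : 0 < 1 - 2 * m r / r := by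
    rw [sub_pos, div_lt_one hr0]; linarith
  have hY : 0 < 2 * ρ r - 1 := by linarith
  refine ⟨hr0, hr1, h1, by linarith, hmpos.le, hmr, ?_, ?_, ?_⟩
  · have : π * r ^ 3 ≤ 3.15 * r ^ 3 := by gcongr
    have : 0 < r ^ 3 := by positivity
    nlinarith
  · have := Real.sqrt_pos.2 hX
    have := Real.sqrt_pos.2 hY
    unfold gfun
    positivity
  · have := Real.sqrt_pos.2 hY
    have e1 := Real.sq_sqrt hX.le
    have e2 := Real.sq_sqrt hY.le
    unfold gfun
    rw [div_pow, mul_pow, e1, e2]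
    field_simp
    ring

/-- The areal radius is positive away from the centre: its derivative takes the value `0` at a
zero and values at least `1` elsewhere, which Darboux's theorem forbids. -/
lemma IsComoving.radius_pos {R B : ℝ} {m ρ r₀ : ℝ → ℝ} (hc : IsComoving R B m ρ r₀)
    (hsb : ∀ r ∈ Ioc 0 R, SmallBackground r (m r) (ρ r) (gfun m ρ r)) (hR : 0 < R)
    {χ : ℝ} (hχ : χ ∈ Ioc 0 B) : 0 < r₀ χ := by
  obtain ⟨hB, -, hrB, -, hmem, hder⟩ := hc
  refine lt_of_le_of_ne (hmem χ (Ioc_subset_Icc_self hχ)).1 fun h0 => ?_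
  have hg0 : gfun m ρ 0 = 0 := by simp [gfun]
  have hgB : 1 ≤ gfun m ρ (r₀ B) := by
    rw [hrB]; exact (hsb R ⟨hR, le_rfl⟩).one_le_g
  have hD := exists_hasDerivWithinAt_eq_of_gt_of_lt (f := r₀) (f' := fun s => gfun m ρ (r₀ s))
    (a := χ) (b := B) hχ.2
    (fun x hx => (hder x ⟨hχ.1.trans_le hx.1, hx.2⟩).hasDerivWithinAt)
    (m := 1 / 2) (by simp only [← h0, hg0]; norm_num) (by linarith)
  obtain ⟨x, hx, hx2⟩ := hD
  have hx' := hmem x ⟨hχ.1.le.trans hx.1.le, hx.2.le⟩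
  simp only at hx2
  rcases hx'.1.eq_or_lt with h | h
  · rw [← h, hg0] at hx2; norm_num at hx2
  · linarith [(hsb _ ⟨h, hx'.2⟩).one_le_g]

/-- The exponent of the weight in the second variation. -/
def weightExponent (m ρ r₀ : ℝ → ℝ) (χ : ℝ) : ℝ :=
  ∫ s in (0:ℝ)..χ, 1 / (4 * π * r₀ s ^ 3 * gfun m ρ (r₀ s))

lemma Qint_eq (m ρ r₀ u v : ℝ → ℝ) (χ : ℝ) :
    Qint m ρ r₀ u v χ = secondVariationDensity (r₀ χ) (m (r₀ χ)) (ρ (r₀ χ))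
      (gfun m ρ (r₀ χ)) (u χ) (deriv u χ) (v χ) * Real.exp (weightExponent m ρ r₀ χ) := rfl

section Coercivity

variable {R B : ℝ} {m ρ r₀ u v : ℝ → ℝ}

lemma IsComoving.continuousOn_comp {f : ℝ → ℝ} (hc : IsComoving R B m ρ r₀)
    (hf : ContinuousOn f (Icc 0 R)) : ContinuousOn (fun s => f (r₀ s)) (Icc 0 B) :=
  hf.comp hc.2.2.2.1 fun x hx => hc.2.2.2.2.1 x hx

lemma IsComoving.continuousOn_gfun (hc : IsComoving R B m ρ r₀)
    (hm : ContinuousOn m (Icc 0 R)) (hρ : ContinuousOn ρ (Icc 0 R))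
    (hsb : ∀ χ ∈ Ioc 0 B,
      SmallBackground (r₀ χ) (m (r₀ χ)) (ρ (r₀ χ)) (gfun m ρ (r₀ χ))) :
    ContinuousOn (fun s => gfun m ρ (r₀ s)) (Ioc 0 B) := by
  have h1 := (hc.continuousOn_comp hm).mono Ioc_subset_Icc_self
  have h2 := (hc.continuousOn_comp hρ).mono Ioc_subset_Icc_self
  have h3 := hc.2.2.2.1.mono Ioc_subset_Icc_self
  unfold gfun
  refine ContinuousOn.div ?_ ?_ fun x hx => ?_
  · exact (continuousOn_const.sub ((continuousOn_const.mul h1).div h3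
      fun x hx => (hsb x hx).r_pos.ne')).sqrt
  · exact (continuousOn_const.mul (h3.pow 2)).mul
      ((continuousOn_const.mul h2).sub continuousOn_const).sqrt
  · have hr := (hsb x hx).r_pos
    have : 0 < √(2 * ρ (r₀ x) - 1) := Real.sqrt_pos.2 (by linarith [(hsb x hx).one_le_p])
    positivity

lemma IsComoving.integrableOn_gfun (hc : IsComoving R B m ρ r₀)
    (hsb : ∀ χ ∈ Ioc 0 B,
      SmallBackground (r₀ χ) (m (r₀ χ)) (ρ (r₀ χ)) (gfun m ρ (r₀ χ))) :
    MeasureTheory.IntegrableOn (fun s => gfun m ρ (r₀ s)) (Ioc 0 B) :=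
  intervalIntegral.integrableOn_deriv_of_nonneg hc.2.2.2.1
    (fun x hx => hc.2.2.2.2.2 x (Ioo_subset_Ioc_self hx))
    (fun x hx => (hsb x (Ioo_subset_Ioc_self hx)).g_pos.le)

lemma IsComoving.continuousOn_weight (hc : IsComoving R B m ρ r₀)
    (hm : ContinuousOn m (Icc 0 R)) (hρ : ContinuousOn ρ (Icc 0 R))
    (hsb : ∀ χ ∈ Ioc 0 B,
      SmallBackground (r₀ χ) (m (r₀ χ)) (ρ (r₀ χ)) (gfun m ρ (r₀ χ))) :
    ContinuousOn (fun s => 1 / (4 * π * r₀ s ^ 3 * gfun m ρ (r₀ s))) (Ioc 0 B) := by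
  refine continuousOn_const.div ((continuousOn_const.mul
    ((hc.2.2.2.1.mono Ioc_subset_Icc_self).pow 3)).mul (hc.continuousOn_gfun hm hρ hsb))
    fun x hx => ?_
  have := (hsb x hx).r_pos
  have := (hsb x hx).g_pos
  have := Real.pi_pos
  positivity

lemma IsComoving.integrableOn_weight (hc : IsComoving R B m ρ r₀)
    (hm : ContinuousOn m (Icc 0 R)) (hρ : ContinuousOn ρ (Icc 0 R))
    (hsb : ∀ χ ∈ Ioc 0 B,
      SmallBackground (r₀ χ) (m (r₀ χ)) (ρ (r₀ χ)) (gfun m ρ (r₀ χ))) :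
    MeasureTheory.IntegrableOn
      (fun s => 1 / (4 * π * r₀ s ^ 3 * gfun m ρ (r₀ s))) (Icc 0 B) := by
  rw [integrableOn_Icc_iff_integrableOn_Ioc]
  refine MeasureTheory.Integrable.mono' (hc.integrableOn_gfun hsb)
    ((hc.continuousOn_weight hm hρ hsb).aestronglyMeasurable measurableSet_Ioc) ?_
  refine (MeasureTheory.ae_restrict_iff' measurableSet_Ioc).2 (Eventually.of_forall fun x hx => ?_)
  have := (hsb x hx).r_pos
  have := (hsb x hx).g_pos
  have := Real.pi_pos
  rw [Real.norm_of_nonneg (by positivity)]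
  exact (hsb x hx).weight_le_g

lemma IsComoving.continuousOn_weightExponent (hc : IsComoving R B m ρ r₀)
    (hm : ContinuousOn m (Icc 0 R)) (hρ : ContinuousOn ρ (Icc 0 R))
    (hsb : ∀ χ ∈ Ioc 0 B,
      SmallBackground (r₀ χ) (m (r₀ χ)) (ρ (r₀ χ)) (gfun m ρ (r₀ χ))) :
    ContinuousOn (weightExponent m ρ r₀) (Icc 0 B) := by
  have h := hc.integrableOn_weight hm hρ hsb
  rw [← uIcc_of_le hc.1.le] at h ⊢
  exact intervalIntegral.continuousOn_primitive_interval h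

lemma IsComoving.hasDerivAt_weightExponent (hc : IsComoving R B m ρ r₀)
    (hm : ContinuousOn m (Icc 0 R)) (hρ : ContinuousOn ρ (Icc 0 R))
    (hsb : ∀ χ ∈ Ioc 0 B,
      SmallBackground (r₀ χ) (m (r₀ χ)) (ρ (r₀ χ)) (gfun m ρ (r₀ χ)))
    {χ : ℝ} (hχ : χ ∈ Ioo 0 B) :
    HasDerivAt (weightExponent m ρ r₀) (1 / (4 * π * r₀ χ ^ 3 * gfun m ρ (r₀ χ))) χ := by
  have hcont := (hc.continuousOn_weight hm hρ hsb).mono Ioo_subset_Ioc_self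
  refine intervalIntegral.integral_hasDerivAt_right ?_
    (hcont.stronglyMeasurableAtFilter isOpen_Ioo χ hχ)
    (hcont.continuousAt (isOpen_Ioo.mem_nhds hχ))
  rw [intervalIntegrable_iff_integrableOn_Icc_of_le hχ.1.le]
  exact (hc.integrableOn_weight hm hρ hsb).mono_set (Icc_subset_Icc_right hχ.2.le)

lemma IsComoving.weightExponent_nonneg (hc : IsComoving R B m ρ r₀)
    (hsb : ∀ χ ∈ Ioc 0 B,
      SmallBackground (r₀ χ) (m (r₀ χ)) (ρ (r₀ χ)) (gfun m ρ (r₀ χ)))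
    {χ : ℝ} (hχ : χ ∈ Icc 0 B) : 0 ≤ weightExponent m ρ r₀ χ := by
  refine intervalIntegral.integral_nonneg hχ.1 fun s hs => ?_
  rcases hs.1.eq_or_lt with rfl | h
  · simp [hc.2.1]
  · have := (hsb s ⟨h, hs.2.trans hχ.2⟩).r_pos
    have := (hsb s ⟨h, hs.2.trans hχ.2⟩).g_pos
    have := Real.pi_pos
    positivity

lemma C1On.continuousOn {f : ℝ → ℝ} {s : Set ℝ} (hf : C1On f s) : ContinuousOn f s :=
  fun x hx => (hf.1 x hx).continuousAt.continuousWithinAt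

lemma IsComoving.integrableOn_Qint (hc : IsComoving R B m ρ r₀)
    (hm : ContinuousOn m (Icc 0 R)) (hρ : ContinuousOn ρ (Icc 0 R))
    (hsb : ∀ χ ∈ Ioc 0 B,
      SmallBackground (r₀ χ) (m (r₀ χ)) (ρ (r₀ χ)) (gfun m ρ (r₀ χ)))
    (hu : C1On u (Icc 0 B)) (hv : ContinuousOn v (Icc 0 B)) :
    MeasureTheory.IntegrableOn (Qint m ρ r₀ u v) (Icc 0 B) := by
  obtain ⟨A₁, hA₁⟩ := isCompact_Icc.exists_bound_of_continuousOn hu.continuousOn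
  obtain ⟨A₂, hA₂⟩ := isCompact_Icc.exists_bound_of_continuousOn hu.2
  obtain ⟨A₃, hA₃⟩ := isCompact_Icc.exists_bound_of_continuousOn hv
  have hW := hc.continuousOn_weightExponent hm hρ hsb
  obtain ⟨A₄, hA₄⟩ := isCompact_Icc.exists_bound_of_continuousOn hW.rexp
  set A := max A₁ (max A₂ A₃)
  rw [integrableOn_Icc_iff_integrableOn_Ioc]
  refine MeasureTheory.Integrable.mono'
    ((hc.integrableOn_gfun hsb).const_mul (200 * A ^ 2 * A₄)) ?_ ?_
  · have meas : ∀ {f : ℝ → ℝ}, ContinuousOn f (Icc 0 B) →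
        AEMeasurable f (MeasureTheory.volume.restrict (Ioc 0 B)) := fun hf =>
      (hf.mono Ioc_subset_Icc_self).aemeasurable measurableSet_Ioc
    have h1 := meas (hc.continuousOn_comp hm)
    have h2 := meas (hc.continuousOn_comp hρ)
    have h3 := meas hc.2.2.2.1
    have h4 := meas hu.continuousOn
    have h5 := meas hu.2
    have h6 := meas hv
    have h7 := meas hW
    have h8 := (hc.continuousOn_gfun hm hρ hsb).aemeasurable
      (μ := MeasureTheory.volume) measurableSet_Ioc
    refine AEMeasurable.aestronglyMeasurable ?_
    change AEMeasurable (fun χ => Qint m ρ r₀ u v χ) _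
    exact (aemeasurable_secondVariationDensity h3 h1 h2 h8 h4 h5 h6).mul h7.exp
  · refine (MeasureTheory.ae_restrict_iff' measurableSet_Ioc).2
      (Eventually.of_forall fun x hx => ?_)
    have hx' := Ioc_subset_Icc_self hx
    have h1 := (hsb x hx).abs_density_le (A := A) ((hA₁ x hx').trans (le_max_left _ _))
      ((hA₂ x hx').trans ((le_max_left _ _).trans (le_max_right _ _)))
      ((hA₃ x hx').trans ((le_max_right _ _).trans (le_max_right _ _)))
    rw [Qint_eq, norm_mul]
    calc _ ≤ 200 * A ^ 2 * gfun m ρ (r₀ x) * A₄ :=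
          mul_le_mul h1 (hA₄ x hx') (norm_nonneg _) ((abs_nonneg _).trans h1)
      _ = _ := by ring

/-- The second variation controls `u` pointwise. -/
lemma IsComoving.radius_mul_sq_le_Qform (hc : IsComoving R B m ρ r₀)
    (hm : ContinuousOn m (Icc 0 R)) (hρ : ContinuousOn ρ (Icc 0 R))
    (hsb : ∀ χ ∈ Ioc 0 B,
      SmallBackground (r₀ χ) (m (r₀ χ)) (ρ (r₀ χ)) (gfun m ρ (r₀ χ)))
    (hu : C1On u (Icc 0 B)) (hv : ContinuousOn v (Icc 0 B)) {χ : ℝ} (hχ : χ ∈ Icc 0 B) :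
    2 * π * (r₀ χ * u χ ^ 2) ≤ Qform m ρ r₀ B u v := by
  have hint := hc.integrableOn_Qint hm hρ hsb hu hv
  have hπ := Real.pi_pos
  set F : ℝ → ℝ := fun s => r₀ s * u s ^ 2 * Real.exp (weightExponent m ρ r₀ s) with hF
  have hFc : ContinuousOn F (Icc 0 B) :=
    (hc.2.2.2.1.mul (hu.continuousOn.pow 2)).mul
      (hc.continuousOn_weightExponent hm hρ hsb).rexp
  have hFd : ∀ s ∈ Ioo 0 B, HasDerivAt F
      ((gfun m ρ (r₀ s) * u s ^ 2 + 2 * r₀ s * u s * deriv u s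
        + r₀ s * u s ^ 2 * (1 / (4 * π * r₀ s ^ 3 * gfun m ρ (r₀ s))))
        * Real.exp (weightExponent m ρ r₀ s)) s := fun s hs => by
    have h1 := hc.2.2.2.2.2 s (Ioo_subset_Ioc_self hs)
    have h2 := (hu.1 s (Ioo_subset_Icc_self hs)).hasDerivAt
    have h3 := (hc.hasDerivAt_weightExponent hm hρ hsb hs).exp
    refine ((h1.mul (h2.pow 2)).mul h3).congr_deriv ?_
    simp only [Pi.mul_apply, Pi.pow_apply]
    push_cast
    ring
  have key : ∀ κ ∈ Icc (4 : ℝ) 5, ∀ a b : ℝ, 0 ≤ a → a ≤ b → b ≤ B →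
      2 * π * κ * F b - 2 * π * κ * F a ≤ ∫ s in a..b, Qint m ρ r₀ u v s := by
    intro κ hκ a b ha hab hb
    refine intervalIntegral.sub_le_integral_of_hasDeriv_right_of_le
      (g := fun s => 2 * π * κ * F s) hab
      (continuousOn_const.mul (hFc.mono (Icc_subset_Icc ha hb)))
      (fun s hs => ((hFd s ⟨ha.trans_lt hs.1, hs.2.trans_le hb⟩).const_mul
        (2 * π * κ)).hasDerivWithinAt)
      (hint.mono_set (Icc_subset_Icc ha hb)) fun s hs => ?_
    rw [Qint_eq, ← mul_assoc]
    gcongr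
    exact (hsb s ⟨ha.trans_lt hs.1, (hs.2.trans_le hb).le⟩).le_density hκ _ _ _
  have hk1 := key 5 ⟨by norm_num, le_rfl⟩ 0 χ le_rfl hχ.1 hχ.2
  have hk2 := key 4 ⟨le_rfl, by norm_num⟩ χ B hχ.1 hχ.2 le_rfl
  have hF0 : F 0 = 0 := by simp [hF, hc.2.1]
  have hFB : 0 ≤ F B := by
    have := (hc.2.2.2.2.1 B ⟨hc.1.le, le_rfl⟩).1
    simp only [hF]
    positivity
  have hsum : (∫ s in (0:ℝ)..χ, Qint m ρ r₀ u v s) + (∫ s in χ..B, Qint m ρ r₀ u v s)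
      = Qform m ρ r₀ B u v := by
    refine intervalIntegral.integral_add_adjacent_intervals ?_ ?_
    · rw [intervalIntegrable_iff_integrableOn_Icc_of_le hχ.1]
      exact hint.mono_set (Icc_subset_Icc_right hχ.2)
    · rw [intervalIntegrable_iff_integrableOn_Icc_of_le hχ.2]
      exact hint.mono_set (Icc_subset_Icc_left hχ.1)
  have hFχ : r₀ χ * u χ ^ 2 ≤ F χ := by
    have h0 : 0 ≤ r₀ χ * u χ ^ 2 := mul_nonneg (hc.2.2.2.2.1 χ hχ).1 (sq_nonneg _)
    exact le_mul_of_one_le_right h0 (Real.one_le_exp (hc.weightExponent_nonneg hsb hχ))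
  have h1 : 2 * π * (r₀ χ * u χ ^ 2) ≤ 2 * π * F χ := by gcongr
  have h2 : 0 ≤ π * F B := by positivity
  rw [hF0] at hk1
  linarith

end Coercivity

/-- The first variation of the mass aspect function is controlled by `r u²`. -/
lemma SmallBackground.sq_massAspect_le {r M p g : ℝ} (h : SmallBackground r M p g) {ε : ℝ}
    (hε : ε ∈ Icc (0 : ℝ) (1 / 2)) (a : ℝ) :
    (-(4 * π) * r ^ (1 - ε) * (p - 1) * a - (1 + ε) * (M / r ^ (2 + ε)) * a) ^ 2 ≤
      400 * r ^ (1 / 2 - ε) * (r * a ^ 2) := by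
  obtain ⟨hε0, hε1⟩ := hε
  have hr := h.r_pos
  have hπ := Real.pi_pos
  have e1 : M / r ^ (2 + ε) = M / r ^ 3 * r ^ (1 - ε) := by
    have e : r ^ (3 : ℕ) = r ^ (2 + ε) * r ^ (1 - ε) := by
      rw [← Real.rpow_add hr, ← Real.rpow_natCast]
      congr 1
      push_cast
      ring
    have := Real.rpow_pos_of_pos hr (1 - ε)
    have := Real.rpow_pos_of_pos hr (2 + ε)
    rw [e]
    field_simp
  have e2 : (r ^ (1 - ε)) ^ 2 = r ^ (1 / 2 - ε) * r ^ (1 / 2 - ε) * r := by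
    rw [← Real.rpow_add hr, ← Real.rpow_add_one hr.ne', ← Real.rpow_natCast, ← Real.rpow_mul hr.le]
    congr 1
    push_cast
    ring
  have hle : r ^ (1 / 2 - ε) ≤ 1 :=
    Real.rpow_le_one hr.le (by linarith [h.r_le_one]) (by linarith)
  have hpos : 0 < r ^ (1 / 2 - ε) := Real.rpow_pos_of_pos hr _
  have hM0 : 0 ≤ M / r ^ 3 := div_nonneg h.M_nonneg (by positivity)
  have hM : M / r ^ 3 ≤ 9 := by
    rw [div_le_iff₀ (by positivity)]; exact h.M_le_cube
  have hp : 0 ≤ p - 1 := by linarith [h.one_le_p]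
  have hcoef : 4 * π * (p - 1) + (1 + ε) * (M / r ^ 3) ≤ 20 := by
    have h1 : 4 * π * (p - 1) ≤ 4 * 4 * (1 / 100) := by
      gcongr
      · exact Real.pi_lt_four.le
      · linarith [h.p_le]
    have h2 : (1 + ε) * (M / r ^ 3) ≤ (1 + 1 / 2) * 9 := by gcongr
    linarith
  have hcoef0 : 0 ≤ 4 * π * (p - 1) + (1 + ε) * (M / r ^ 3) := by positivity
  calc (-(4 * π) * r ^ (1 - ε) * (p - 1) * a - (1 + ε) * (M / r ^ (2 + ε)) * a) ^ 2
      = (4 * π * (p - 1) + (1 + ε) * (M / r ^ 3)) ^ 2 * (r ^ (1 - ε)) ^ 2 * a ^ 2 := by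
        rw [e1]; ring
    _ = (4 * π * (p - 1) + (1 + ε) * (M / r ^ 3)) ^ 2 *
          (r ^ (1 / 2 - ε) * (r ^ (1 / 2 - ε) * (r * a ^ 2))) := by
        rw [e2]; ring
    _ ≤ 20 ^ 2 * (r ^ (1 / 2 - ε) * (1 * (r * a ^ 2))) := by gcongr
    _ = _ := by ring

/-- The second variation of the mass functional controls, pointwise, the first
variation of the mass aspect function `(m/r^{1+ε})˙`. -/
theorem stmt10 :
    ∀ Cs > (0:ℝ), ∃ R₀ > (0:ℝ), ∀ ε ∈ Icc (0:ℝ) (1/2), ∃ Cε > (0:ℝ),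
      ∀ (R B : ℝ) (m ρ r₀ : ℝ → ℝ),
        IsSmallStar Cs R m ρ → R < R₀ → IsComoving R B m ρ r₀ →
        ∀ u v : ℝ → ℝ, C1On u (Icc 0 B) → u 0 = 0 → ContinuousOn v (Icc 0 B) →
        ∀ χ ∈ Icc (0:ℝ) B,
          (-(4 * π) * r₀ χ ^ (1 - ε) * (ρ (r₀ χ) - 1) * u χ
            - (1 + ε) * (m (r₀ χ) / r₀ χ ^ (2 + ε)) * u χ) ^ 2 ≤
            Cε * r₀ χ ^ (1/2 - ε) * Qform m ρ r₀ B u v := by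
  intro Cs hCs
  refine ⟨1 / (40 * (1 + Cs)), by positivity, fun ε hε => ⟨400, by norm_num, ?_⟩⟩
  intro R B m ρ r₀ hs hR hc u v hu hu0 hv χ hχ
  have hstar : ∀ r ∈ Ioc 0 R, SmallBackground r (m r) (ρ r) (gfun m ρ r) :=
    fun r hr => hs.smallBackground hCs hR hr
  have hsb : ∀ χ ∈ Ioc 0 B,
      SmallBackground (r₀ χ) (m (r₀ χ)) (ρ (r₀ χ)) (gfun m ρ (r₀ χ)) := fun χ hχ =>
    hstar _ ⟨hc.radius_pos hstar hs.1 hχ, (hc.2.2.2.2.1 χ (Ioc_subset_Icc_self hχ)).2⟩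
  have hQ := hc.radius_mul_sq_le_Qform hs.2.1 hs.2.2.1 hsb hu hv hχ
  have hr0 := (hc.2.2.2.2.1 χ hχ).1
  have h0 : 0 ≤ r₀ χ * u χ ^ 2 := mul_nonneg hr0 (sq_nonneg _)
  have hQ' : r₀ χ * u χ ^ 2 ≤ Qform m ρ r₀ B u v := by nlinarith [Real.pi_gt_three]
  have hpow : 0 ≤ r₀ χ ^ (1 / 2 - ε) := Real.rpow_nonneg hr0 _
  rcases hχ.1.eq_or_lt with rfl | h
  · have : 0 ≤ Qform m ρ r₀ B u v := h0.trans hQ'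
    rw [hu0, mul_zero, mul_zero, sub_zero, zero_pow two_ne_zero]
    positivity
  · exact ((hsb χ ⟨h, hχ.2⟩).sq_massAspect_le hε (u χ)).trans (by gcongr)

end
end
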